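/- arXiv:1702.04530 — 3 statements merged into one kernel-verified Lean document; each statement's English description precedes it below -/
import Mathlib

section
/- Let q ∈ (1,∞) and 1 > ρ > σ > 1/q. There is a constant C = C(ρ,σ,q,M) > 0, independent of T, such that for every T > 0, every u ∈ C^ρ([0,T],X), and every strongly measurable v : (0,T) → Y with ‖v‖_{L_∞(0,T;Y)} < ∞ and ‖v‖_{W_q^σ((0,T),Y)} < ∞, one has ‖uv‖_{W_q^σ((0,T),Z)} ≤ C·[ ‖u‖_{L_∞(0,T;X)}·‖v‖_{W_q^σ((0,T),Y)} + T^{ρ−σ+1/q}·‖v‖_{L_∞(0,T;Y)}·‖u‖_{C^ρ([0,T],X)} ]. -/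
open MeasureTheory Set ENNReal

/-- The `W_q^σ((0,T),X)` Sobolev–Slobodeckii norm, valued in `ℝ≥0∞`. -/
noncomputable def wsNorm {X : Type*} [NormedAddCommGroup X] (q σ T : ℝ) (u : ℝ → X) : ℝ≥0∞ :=
  (∫⁻ t in Ioo (0:ℝ) T, (‖u t‖₊ : ℝ≥0∞) ^ q) ^ (1 / q) +
    (∫⁻ t in Ioo (0:ℝ) T, ∫⁻ s in Ioo (0:ℝ) T,
        (‖u t - u s‖₊ : ℝ≥0∞) ^ q / (ENNReal.ofReal |t - s|) ^ (1 + σ * q)) ^ (1 / q)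

/-- The `L_∞(0,T;X)` norm (essential supremum), valued in `ℝ≥0∞`. -/
noncomputable def linfNorm {X : Type*} [NormedAddCommGroup X] (T : ℝ) (u : ℝ → X) : ℝ≥0∞ :=
  essSup (fun t => (‖u t‖₊ : ℝ≥0∞)) (volume.restrict (Ioo (0:ℝ) T))

/-- The `C^ρ([0,T],X)` Hölder norm, valued in `ℝ≥0∞`. -/
noncomputable def cHolderNorm {X : Type*} [NormedAddCommGroup X] (ρ T : ℝ) (u : ℝ → X) : ℝ≥0∞ :=
  (⨆ t ∈ Icc (0:ℝ) T, (‖u t‖₊ : ℝ≥0∞)) +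
    ⨆ t ∈ Icc (0:ℝ) T, ⨆ s ∈ Icc (0:ℝ) T, ⨆ _ : t ≠ s,
      (‖u t - u s‖₊ : ℝ≥0∞) / (ENNReal.ofReal |t - s|) ^ ρ

/-- The kernel `x ↦ x ^ (α - 1)` on `(0,T)`, extended by zero to the real line. -/
noncomputable def rpowKernel (α T : ℝ) : ℝ → ℝ≥0∞ :=
  (Ioo (0:ℝ) T).indicator fun x => ENNReal.ofReal (x ^ (α - 1))

theorem measurable_rpowKernel (α T : ℝ) : Measurable (rpowKernel α T) :=
  Measurable.indicator (by fun_prop) measurableSet_Ioo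

theorem lintegral_rpowKernel {α T : ℝ} (hα : 0 < α) (hT : 0 < T) :
    ∫⁻ x, rpowKernel α T x = ENNReal.ofReal (T ^ α / α) := by
  have hint : IntegrableOn (fun x : ℝ => x ^ (α - 1)) (Ioo 0 T) := by
    rw [← intervalIntegrable_iff_integrableOn_Ioo_of_le hT.le]
    exact intervalIntegral.intervalIntegrable_rpow' (by linarith)
  have hnonneg : 0 ≤ᵐ[volume.restrict (Ioo 0 T)] fun x : ℝ => x ^ (α - 1) :=
    (ae_restrict_mem measurableSet_Ioo).mono fun x hx => Real.rpow_nonneg hx.1.le _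
  rw [rpowKernel, lintegral_indicator measurableSet_Ioo,
    ← ofReal_integral_eq_lintegral_ofReal hint hnonneg, ← integral_Ioc_eq_integral_Ioo,
    ← intervalIntegral.integral_of_le hT.le, integral_rpow (Or.inl (by linarith))]
  simp [Real.zero_rpow hα.ne']

theorem lintegral_rpowKernel_sub_add {α T : ℝ} (hα : 0 < α) (hT : 0 < T) (t : ℝ) :
    ∫⁻ s, (rpowKernel α T (t - s) + rpowKernel α T (s - t)) = ENNReal.ofReal (2 * T ^ α / α) := by
  have hm := measurable_rpowKernel α T
  rw [lintegral_add_left (by fun_prop), lintegral_sub_left_eq_self (rpowKernel α T) t,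
    lintegral_sub_right_eq_self (rpowKernel α T) t, lintegral_rpowKernel hα hT,
    ← ENNReal.ofReal_add (by positivity) (by positivity)]
  congr 1
  ring

theorem ofReal_abs_sub_rpow_le_rpowKernel {α T t s : ℝ} (ht : t ∈ Ioo (0:ℝ) T)
    (hs : s ∈ Ioo (0:ℝ) T) (hts : t ≠ s) :
    ENNReal.ofReal |t - s| ^ (α - 1) ≤ rpowKernel α T (t - s) + rpowKernel α T (s - t) := by
  rw [ENNReal.ofReal_rpow_of_pos (abs_pos.2 (sub_ne_zero.2 hts))]
  rcases hts.lt_or_gt with h | h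
  · have hmem : s - t ∈ Ioo 0 T := ⟨by linarith, by linarith [ht.1, hs.2]⟩
    rw [abs_sub_comm, abs_of_pos hmem.1]
    refine le_add_left ?_
    rw [rpowKernel, indicator_of_mem hmem]
  · have hmem : t - s ∈ Ioo 0 T := ⟨by linarith, by linarith [hs.1, ht.2]⟩
    rw [abs_of_pos hmem.1]
    refine le_add_right ?_
    rw [rpowKernel, indicator_of_mem hmem]

theorem nnnorm_sub_le_cHolderNorm {X : Type*} [NormedAddCommGroup X] {ρ T : ℝ} (u : ℝ → X)
    {t s : ℝ} (ht : t ∈ Icc (0:ℝ) T) (hs : s ∈ Icc (0:ℝ) T) (hts : t ≠ s) :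
    (‖u t - u s‖₊ : ℝ≥0∞) ≤ cHolderNorm ρ T u * ENNReal.ofReal |t - s| ^ ρ := by
  have hpos : 0 < ENNReal.ofReal |t - s| :=
    ENNReal.ofReal_pos.2 (abs_pos.2 (sub_ne_zero.2 hts))
  rw [← ENNReal.div_le_iff_le_mul
    (Or.inl (ENNReal.rpow_pos hpos ENNReal.ofReal_ne_top).ne')
    (Or.inl (ENNReal.rpow_ne_top_of_ne_zero hpos.ne' ENNReal.ofReal_ne_top))]
  refine le_add_left ?_
  exact le_iSup₂_of_le t ht (le_iSup₂_of_le s hs (le_iSup_of_le hts le_rfl))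

theorem linfNorm_le_cHolderNorm {X : Type*} [NormedAddCommGroup X] (ρ T : ℝ) (u : ℝ → X) :
    linfNorm T u ≤ cHolderNorm ρ T u := by
  refine essSup_le_of_ae_le _ ((ae_restrict_mem measurableSet_Ioo).mono fun t ht => ?_)
  exact le_add_right
    (le_iSup₂_of_le (f := fun t (_ : t ∈ Icc (0:ℝ) T) => (‖u t‖₊ : ℝ≥0∞)) t
      (Ioo_subset_Icc_self ht) le_rfl)

/-- Pointwise bound for the Slobodeckii difference quotient of a product. -/
theorem add_rpow_div_le {q ρ σ : ℝ} (hq : 1 < q) {n a b D : ℝ≥0∞} {c d : ℝ≥0∞}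
    (hD : D ≠ 0) (hD' : D ≠ ⊤) (hn : n ≤ c * a + d * b) (hb : b ≤ D ^ ρ) :
    n ^ q / D ^ (1 + σ * q) ≤
      2 ^ (q - 1) * c ^ q * (a ^ q / D ^ (1 + σ * q)) +
        2 ^ (q - 1) * d ^ q * D ^ ((ρ - σ) * q - 1) := by
  have hq0 : 0 ≤ q := by linarith
  have hpow : (D ^ ρ) ^ q / D ^ (1 + σ * q) = D ^ ((ρ - σ) * q - 1) := by
    rw [← ENNReal.rpow_mul, ← ENNReal.rpow_sub _ _ hD hD']
    congr 1
    ring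
  calc n ^ q / D ^ (1 + σ * q)
      ≤ (c * a + d * D ^ ρ) ^ q / D ^ (1 + σ * q) := by gcongr; exact hn.trans (by gcongr)
    _ ≤ (2 ^ (q - 1) * ((c * a) ^ q + (d * D ^ ρ) ^ q)) / D ^ (1 + σ * q) := by
        gcongr; exact ENNReal.rpow_add_le_mul_rpow_add_rpow _ _ hq.le
    _ = _ := by
        rw [ENNReal.mul_rpow_of_nonneg _ _ hq0, ENNReal.mul_rpow_of_nonneg _ _ hq0, ← hpow]
        simp only [div_eq_mul_inv]
        ring

theorem statement6 {X Y Z : Type*}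
    [NormedAddCommGroup X] [NormedSpace ℝ X] [CompleteSpace X]
    [NormedAddCommGroup Y] [NormedSpace ℝ Y] [CompleteSpace Y]
    [NormedAddCommGroup Z] [NormedSpace ℝ Z] [CompleteSpace Z]
    (B : X →ₗ[ℝ] Y →ₗ[ℝ] Z) (M : ℝ) (hB : ∀ x y, ‖B x y‖ ≤ M * ‖x‖ * ‖y‖)
    (q ρ σ : ℝ) (hq : 1 < q) (hσ : 1 / q < σ) (hσρ : σ < ρ) (hρ : ρ < 1) :
    ∃ C > (0 : ℝ), ∀ T > (0 : ℝ), ∀ u : ℝ → X, ∀ v : ℝ → Y,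
      cHolderNorm ρ T u < ⊤ →
      AEStronglyMeasurable v (volume.restrict (Ioo (0:ℝ) T)) →
      linfNorm T v < ⊤ → wsNorm q σ T v < ⊤ →
      wsNorm q σ T (fun t => B (u t) (v t)) ≤
        ENNReal.ofReal C *
          (linfNorm T u * wsNorm q σ T v +
            ENNReal.ofReal (T ^ (ρ - σ + 1 / q)) * linfNorm T v * cHolderNorm ρ T u) := by
  have hq0 : 0 < q := by linarith
  have hq1 : 1 / q ≤ 1 := by rw [div_le_one hq0]; exact hq.le
  set α : ℝ := (ρ - σ) * q with hα_def
  have hα : 0 < α := mul_pos (by linarith) hq0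
  set m : ℝ := max M 1
  have hm : 0 < m := lt_max_of_lt_right one_pos
  have hBm : ∀ x y, (‖B x y‖₊ : ℝ≥0∞) ≤ ENNReal.ofReal m * ‖x‖₊ * ‖y‖₊ := fun x y => by
    have h : ‖B x y‖ ≤ m * ‖x‖ * ‖y‖ := (hB x y).trans (by gcongr; exact le_max_left _ _)
    rw [← enorm_eq_nnnorm, ← enorm_eq_nnnorm, ← enorm_eq_nnnorm, ← ofReal_norm, ← ofReal_norm,
      ← ofReal_norm, ← ENNReal.ofReal_mul hm.le, ← ENNReal.ofReal_mul (by positivity)]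
    exact ENNReal.ofReal_le_ofReal h
  refine ⟨m * (3 + 2 * (2 / α) ^ (1 / q)), by positivity, fun T hT u v hu _ hv _ => ?_⟩
  set U := linfNorm T u
  set V := linfNorm T v
  set H := cHolderNorm ρ T u
  have hUtop : U ≠ ⊤ := ((linfNorm_le_cHolderNorm ρ T u).trans_lt hu).ne
  have huU : ∀ᵐ t ∂volume.restrict (Ioo (0:ℝ) T), (‖u t‖₊ : ℝ≥0∞) ≤ U := ae_le_essSup
  have hvV : ∀ᵐ t ∂volume.restrict (Ioo (0:ℝ) T), (‖v t‖₊ : ℝ≥0∞) ≤ V := ae_le_essSup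
  set μ := volume.restrict (Ioo (0:ℝ) T) with hμ
  have hmem : ∀ᵐ t ∂μ, t ∈ Ioo (0:ℝ) T := ae_restrict_mem measurableSet_Ioo
  set mE := ENNReal.ofReal m with hmE
  have hmU : (mE * U) ^ q ≠ ⊤ :=
    ENNReal.rpow_ne_top_of_nonneg hq0.le (ENNReal.mul_ne_top ENNReal.ofReal_ne_top hUtop)
  have h2top : (2 : ℝ≥0∞) ^ (q - 1) ≠ ⊤ :=
    ENNReal.rpow_ne_top_of_nonneg (by linarith) (by simp)
  have hroot : ∀ x : ℝ≥0∞, (x ^ q) ^ (1 / q) = x := fun x => by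
    rw [← ENNReal.rpow_mul, mul_one_div_cancel hq0.ne', ENNReal.rpow_one]
  have hlp : (∫⁻ t, (‖B (u t) (v t)‖₊ : ℝ≥0∞) ^ q ∂μ) ^ (1 / q) ≤
      mE * U * (∫⁻ t, (‖v t‖₊ : ℝ≥0∞) ^ q ∂μ) ^ (1 / q) := by
    calc _ ≤ (∫⁻ t, (mE * U) ^ q * (‖v t‖₊ : ℝ≥0∞) ^ q ∂μ) ^ (1 / q) := by
          gcongr ?_ ^ (1 / q)
          refine lintegral_mono_ae (huU.mono fun t ht => ?_)
          rw [← ENNReal.mul_rpow_of_nonneg _ _ hq0.le]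
          gcongr
          exact (hBm _ _).trans (by gcongr)
      _ = _ := by
          rw [lintegral_const_mul' _ _ hmU, ENNReal.mul_rpow_of_nonneg _ _ (by positivity), hroot]
  set K : ℝ≥0∞ := 2 ^ (q - 1) * (mE * V * H) ^ q with hK
  set c : ℝ≥0∞ := 2 ^ (q - 1) * (mE * U) ^ q with hc
  have hctop : c ≠ ⊤ := ENNReal.mul_ne_top h2top hmU
  have hker : Measurable (rpowKernel α T) := measurable_rpowKernel α T
  have hinner : ∀ᵐ t ∂μ, ∫⁻ s, (‖B (u t) (v t) - B (u s) (v s)‖₊ : ℝ≥0∞) ^ q /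
        ENNReal.ofReal |t - s| ^ (1 + σ * q) ∂μ ≤
      c * (∫⁻ s, (‖v t - v s‖₊ : ℝ≥0∞) ^ q / ENNReal.ofReal |t - s| ^ (1 + σ * q) ∂μ) +
        K * ENNReal.ofReal (2 * T ^ α / α) := by
    filter_upwards [huU, hmem] with t htU ht
    have hbound : ∀ᵐ s ∂μ, (‖B (u t) (v t) - B (u s) (v s)‖₊ : ℝ≥0∞) ^ q /
          ENNReal.ofReal |t - s| ^ (1 + σ * q) ≤
        c * ((‖v t - v s‖₊ : ℝ≥0∞) ^ q / ENNReal.ofReal |t - s| ^ (1 + σ * q)) +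
          K * (rpowKernel α T (t - s) + rpowKernel α T (s - t)) := by
      filter_upwards [hvV, hmem] with s hsV hs
      rcases eq_or_ne t s with rfl | hts
      · simp [hq0]
      have hD : ENNReal.ofReal |t - s| ≠ 0 :=
        (ENNReal.ofReal_pos.2 (abs_pos.2 (sub_ne_zero.2 hts))).ne'
      have hn : (‖B (u t) (v t) - B (u s) (v s)‖₊ : ℝ≥0∞) ≤
          mE * U * ‖v t - v s‖₊ + mE * V * H * ENNReal.ofReal |t - s| ^ ρ := by
        have heq : B (u t) (v t) - B (u s) (v s) =
            B (u t) (v t - v s) + B (u t - u s) (v s) := by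
          simp
        rw [heq]
        calc (‖B (u t) (v t - v s) + B (u t - u s) (v s)‖₊ : ℝ≥0∞)
            ≤ ‖B (u t) (v t - v s)‖₊ + ‖B (u t - u s) (v s)‖₊ := mod_cast nnnorm_add_le _ _
          _ ≤ mE * ‖u t‖₊ * ‖v t - v s‖₊ + mE * ‖u t - u s‖₊ * ‖v s‖₊ :=
              add_le_add (hBm _ _) (hBm _ _)
          _ ≤ mE * U * ‖v t - v s‖₊ + mE * (H * ENNReal.ofReal |t - s| ^ ρ) * V := by
              gcongr
              exact nnnorm_sub_le_cHolderNorm u (Ioo_subset_Icc_self ht)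
                (Ioo_subset_Icc_self hs) hts
          _ = _ := by ring
      refine (add_rpow_div_le hq hD ENNReal.ofReal_ne_top hn le_rfl).trans ?_
      gcongr
      exact ofReal_abs_sub_rpow_le_rpowKernel ht hs hts
    refine (lintegral_mono_ae hbound).trans ?_
    rw [lintegral_add_right _ (by fun_prop), lintegral_const_mul' _ _ hctop,
      lintegral_const_mul _ (by fun_prop)]
    gcongr
    exact (setLIntegral_le_lintegral _ _).trans_eq (lintegral_rpowKernel_sub_add hα hT t)
  set I := ∫⁻ t, ∫⁻ s, (‖v t - v s‖₊ : ℝ≥0∞) ^ q /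
    ENNReal.ofReal |t - s| ^ (1 + σ * q) ∂μ ∂μ
  have hconst : (ENNReal.ofReal (2 * T ^ α / α) * ENNReal.ofReal T) ^ (1 / q) =
      ENNReal.ofReal ((2 / α) ^ (1 / q)) * ENNReal.ofReal (T ^ (ρ - σ + 1 / q)) := by
    have hexp : ρ - σ + 1 / q = (α + 1) * (1 / q) := by
      rw [hα_def]; field_simp
    rw [← ENNReal.ofReal_mul (by positivity), ← ENNReal.ofReal_mul (by positivity),
      ENNReal.ofReal_rpow_of_nonneg (by positivity) (by positivity), hexp,
      Real.rpow_mul hT.le (α + 1), ← Real.mul_rpow (by positivity) (by positivity),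
      Real.rpow_add_one hT.ne' α]
    congr 2
    ring
  have htwo : ((2 : ℝ≥0∞) ^ (q - 1)) ^ (1 / q) ≤ 2 := by
    calc ((2 : ℝ≥0∞) ^ (q - 1)) ^ (1 / q) ≤ ((2 : ℝ≥0∞) ^ q) ^ (1 / q) := by
          gcongr
          · norm_num
          · linarith
      _ = 2 := hroot 2
  have hsemi : (∫⁻ t, ∫⁻ s, (‖B (u t) (v t) - B (u s) (v s)‖₊ : ℝ≥0∞) ^ q /
        ENNReal.ofReal |t - s| ^ (1 + σ * q) ∂μ ∂μ) ^ (1 / q) ≤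
      2 * (mE * U) * I ^ (1 / q) + 2 * (mE * V * H) *
        (ENNReal.ofReal ((2 / α) ^ (1 / q)) * ENNReal.ofReal (T ^ (ρ - σ + 1 / q))) := by
    calc _ ≤ (c * I + K * (ENNReal.ofReal (2 * T ^ α / α) * ENNReal.ofReal T)) ^ (1 / q) := by
          gcongr ?_ ^ (1 / q)
          refine (lintegral_mono_ae hinner).trans_eq ?_
          rw [lintegral_add_right _ measurable_const, lintegral_const_mul' _ _ hctop,
            lintegral_const, hμ, Measure.restrict_apply_univ, Real.volume_Ioo, sub_zero,
            mul_assoc K]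
      _ ≤ (c * I) ^ (1 / q) +
          (K * (ENNReal.ofReal (2 * T ^ α / α) * ENNReal.ofReal T)) ^ (1 / q) :=
          ENNReal.rpow_add_le_add_rpow _ _ (by positivity) hq1
      _ ≤ _ := by
          rw [ENNReal.mul_rpow_of_nonneg c _ (by positivity),
            ENNReal.mul_rpow_of_nonneg K _ (by positivity), hconst, hc, hK,
            ENNReal.mul_rpow_of_nonneg (2 ^ (q - 1)) _ (by positivity),
            ENNReal.mul_rpow_of_nonneg (2 ^ (q - 1)) _ (by positivity), hroot, hroot]
          gcongr
  have hC : ENNReal.ofReal (m * (3 + 2 * (2 / α) ^ (1 / q))) =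
      mE * (3 + 2 * ENNReal.ofReal ((2 / α) ^ (1 / q))) := by
    rw [ENNReal.ofReal_mul hm.le, ENNReal.ofReal_add (by positivity) (by positivity),
      ENNReal.ofReal_mul (by positivity)]
    simp [hmE]
  have hws : wsNorm q σ T v = (∫⁻ t, (‖v t‖₊ : ℝ≥0∞) ^ q ∂μ) ^ (1 / q) + I ^ (1 / q) := rfl
  refine (add_le_add hlp hsemi).trans ?_
  rw [hC, hws]
  set L := (∫⁻ t, (‖v t‖₊ : ℝ≥0∞) ^ q ∂μ) ^ (1 / q)
  set J := I ^ (1 / q)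
  set k := ENNReal.ofReal ((2 / α) ^ (1 / q))
  set τ := ENNReal.ofReal (T ^ (ρ - σ + 1 / q))
  calc mE * U * L + (2 * (mE * U) * J + 2 * (mE * V * H) * (k * τ))
      ≤ mE * U * L + (2 * (mE * U) * J + 2 * (mE * V * H) * (k * τ)) +
        (mE * U * (2 * L + J + 2 * k * (L + J)) + 3 * (mE * (τ * V * H))) := le_self_add
    _ = mE * (3 + 2 * k) * (U * (L + J) + τ * V * H) := by ring
end

section
/- Let q ∈ (1,∞), 1 > ρ > σ > 1/q, and 0 ≤ ε < σ − 1/q. There is a constant C = C(ρ,σ,q,ε,M) > 0, independent of T, such that for every T > 0, every u ∈ C^ρ([0,T],X) with u(0) = 0, and every continuous v : [0,T] → Y with v(0) = 0 and ‖v‖_{W_q^σ((0,T),Y)} < ∞, one has ‖uv‖_{W_q^σ((0,T),Z)} ≤ C·[ T^ρ·‖u‖_{C^ρ([0,T],X)}·‖v‖_{W_q^σ((0,T),Y)} + T^{ρ+ε−σ+1/q}·‖v‖_{W_q^σ((0,T),Y)}·‖u‖_{C^ρ([0,T],X)} ]. -/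
open MeasureTheory Set ENNReal

/-- The substitution `x ↦ c * x` on an interval `(0,R)`. -/
lemma setLIntegral_Ioo_comp_mul_left (f : ℝ → ℝ≥0∞) {c : ℝ} (hc : 0 < c) (R : ℝ) :
    ∫⁻ x in Ioo 0 R, f (c * x) = ENNReal.ofReal c⁻¹ * ∫⁻ x in Ioo 0 (c * R), f x := by
  have hemb : MeasurableEmbedding (fun x : ℝ => c * x) :=
    (Homeomorph.mulLeft₀ c hc.ne').measurableEmbedding
  have hmap := Real.map_volume_mul_left hc.ne'
  rw [abs_of_pos (inv_pos.2 hc)] at hmap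
  rw [← lintegral_indicator measurableSet_Ioo, ← lintegral_indicator measurableSet_Ioo,
    ← smul_eq_mul, ← lintegral_smul_measure, ← hmap, hemb.lintegral_map]
  refine lintegral_congr fun x => ?_
  by_cases hx : x ∈ Ioo 0 R
  · have : c * x ∈ Ioo 0 (c * R) := ⟨mul_pos hc hx.1, by gcongr; exact hx.2⟩
    simp [hx, this]
  · have : c * x ∉ Ioo 0 (c * R) := fun h =>
      hx ⟨pos_of_mul_pos_right h.1 hc.le, lt_of_mul_lt_mul_left h.2 hc.le⟩
    simp [hx, this]

/-- Dilating by `d ≤ 1` costs at most the factor `d ^ (p - 1) * T ^ p` against the weight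
`t ^ (-p)`. -/
lemma setLIntegral_Ioo_comp_mul_le_weighted (g : ℝ → ℝ≥0∞) {d T p : ℝ} (hd : 0 < d) (hd1 : d ≤ 1)
    (hT : 0 < T) (hp : 0 ≤ p) :
    ∫⁻ t in Ioo 0 T, g (d * t) ≤
      ENNReal.ofReal (d ^ (p - 1) * T ^ p) *
        ∫⁻ t in Ioo 0 T, g t * ENNReal.ofReal (t ^ (-p)) := by
  rw [setLIntegral_Ioo_comp_mul_left g hd]
  have h1 : ∫⁻ t in Ioo 0 (d * T), g t ≤
      ∫⁻ t in Ioo 0 (d * T), ENNReal.ofReal ((d * T) ^ p) *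
        (g t * ENNReal.ofReal (t ^ (-p))) := by
    refine setLIntegral_mono' measurableSet_Ioo fun t ht => ?_
    have h2 : (1 : ℝ≥0∞) ≤ ENNReal.ofReal ((d * T) ^ p) * ENNReal.ofReal (t ^ (-p)) := by
      rw [← ENNReal.ofReal_mul (by positivity), ENNReal.one_le_ofReal, Real.rpow_neg ht.1.le,
        ← div_eq_mul_inv, one_le_div (Real.rpow_pos_of_pos ht.1 _)]
      exact Real.rpow_le_rpow ht.1.le ht.2.le hp
    calc g t = g t * 1 := (mul_one _).symm
      _ ≤ g t * (ENNReal.ofReal ((d * T) ^ p) * ENNReal.ofReal (t ^ (-p))) := by gcongr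
      _ = _ := by ring
  rw [lintegral_const_mul' _ _ ENNReal.ofReal_ne_top] at h1
  have h3 : d ^ (p - 1) * T ^ p = d⁻¹ * (d * T) ^ p := by
    rw [Real.mul_rpow hd.le hT.le, Real.rpow_sub_one hd.ne']
    field_simp
  rw [h3, ENNReal.ofReal_mul (by positivity), mul_assoc]
  gcongr
  refine h1.trans ?_
  gcongr
  nlinarith

lemma rpow_ofReal_mul_rpow_one_div {q σ d T : ℝ} (hq : 0 < q) (hd : 0 < d) (hT : 0 < T)
    (A : ℝ≥0∞) :
    (ENNReal.ofReal (d ^ (σ * q - 1) * T ^ (σ * q)) * A) ^ (1 / q) =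
      ENNReal.ofReal (d ^ (σ - 1 / q)) * (ENNReal.ofReal (T ^ σ) * A ^ (1 / q)) := by
  rw [ENNReal.mul_rpow_of_nonneg _ _ (by positivity), ← mul_assoc,
    ← ENNReal.ofReal_mul (by positivity), ENNReal.ofReal_rpow_of_pos (by positivity),
    Real.mul_rpow (by positivity) (by positivity), ← Real.rpow_mul hd.le, ← Real.rpow_mul hT.le]
  congr 4 <;> field_simp

/-- Telescoping along the geometric sequence `c ^ k * t` controls the `L_q` norm of a function
vanishing at `0` by its increments between `t` and `c * t`. -/
lemma lintegral_rpow_le_increment {Y : Type*} [NormedAddCommGroup Y] {v : ℝ → Y}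
    (hv : Continuous v) (hv0 : v 0 = 0) {q σ T c : ℝ} (hq : 1 < q) (hσ : 1 / q < σ)
    (hT : 0 < T) (hc : 0 < c) (hc1 : c < 1 / 2) :
    (∫⁻ t in Ioo 0 T, ‖v t‖ₑ ^ q) ^ (1 / q) ≤
      (1 - ENNReal.ofReal ((1 / 2) ^ (σ - 1 / q)))⁻¹ * (ENNReal.ofReal (T ^ σ) *
        (∫⁻ t in Ioo 0 T, ‖v t - v (c * t)‖ₑ ^ q * ENNReal.ofReal (t ^ (-(σ * q)))) ^ (1 / q)) := by
  have hq0 : 0 < q := by linarith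
  have hσ0 : 0 < σ := lt_trans (by positivity) hσ
  set r := ENNReal.ofReal ((1 / 2) ^ (σ - 1 / q)) with hr
  set S := ENNReal.ofReal (T ^ σ) *
    (∫⁻ t in Ioo 0 T, ‖v t - v (c * t)‖ₑ ^ q * ENNReal.ofReal (t ^ (-(σ * q)))) ^ (1 / q)
  set m : ℕ → ℝ≥0∞ := fun k => (∫⁻ t in Ioo 0 T, ‖v (c ^ k * t)‖ₑ ^ q) ^ (1 / q) with hm
  have hstep : ∀ k, m k ≤ r ^ k * S + m (k + 1) := by
    intro k
    have hck : 0 < c ^ k := pow_pos hc k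
    have h1 : m k ≤ (∫⁻ t in Ioo 0 T, ‖v (c ^ k * t) - v (c * (c ^ k * t))‖ₑ ^ q) ^ (1 / q)
        + m (k + 1) := by
      have hmink := ENNReal.lintegral_Lp_add_le (μ := volume.restrict (Ioo 0 T)) (p := q)
        (f := fun t => ‖v (c ^ k * t) - v (c * (c ^ k * t))‖ₑ)
        (g := fun t => ‖v (c ^ (k + 1) * t)‖ₑ)
        (by fun_prop) (by fun_prop) hq.le
      refine le_trans ?_ hmink
      simp only [hm]
      gcongr with t
      simp only [Pi.add_apply]
      have : c ^ (k + 1) * t = c * (c ^ k * t) := by ring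
      rw [this]
      calc ‖v (c ^ k * t)‖ₑ = ‖(v (c ^ k * t) - v (c * (c ^ k * t))) + v (c * (c ^ k * t))‖ₑ := by
            rw [sub_add_cancel]
        _ ≤ _ := enorm_add_le _ _
    refine h1.trans ?_
    gcongr
    have h2 := setLIntegral_Ioo_comp_mul_le_weighted (fun x => ‖v x - v (c * x)‖ₑ ^ q) hck
      (pow_le_one₀ hc.le (by linarith)) hT (p := σ * q) (by positivity)
    refine (ENNReal.rpow_le_rpow h2 (by positivity)).trans ?_
    rw [rpow_ofReal_mul_rpow_one_div hq0 hck hT]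
    refine mul_le_mul' ?_ le_rfl
    rw [hr, ← ENNReal.ofReal_pow (by positivity)]
    refine ENNReal.ofReal_le_ofReal ?_
    rw [← Real.rpow_natCast, ← Real.rpow_natCast, ← Real.rpow_mul hc.le, mul_comm,
      Real.rpow_mul hc.le]
    gcongr
  have hsum : ∀ n, m 0 ≤ (∑ k ∈ Finset.range n, r ^ k) * S + m n := by
    intro n
    induction n with
    | zero => simp
    | succ n ih =>
      rw [Finset.sum_range_succ, add_mul, add_assoc]
      exact ih.trans (by gcongr; exact hstep n)
  have hlim : Filter.Tendsto m Filter.atTop (nhds 0) := by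
    obtain ⟨K, hK⟩ := (isCompact_Icc (a := (0:ℝ)) (b := T)).exists_bound_of_continuousOn
      hv.continuousOn
    have h1 : Filter.Tendsto (fun n : ℕ => ∫⁻ t in Ioo 0 T, ‖v (c ^ n * t)‖ₑ ^ q) Filter.atTop
        (nhds (∫⁻ _ in Ioo 0 T, 0)) := by
      refine tendsto_lintegral_of_dominated_convergence
        (fun _ => ENNReal.ofReal K ^ q) (fun n => ?_) (fun n => ?_) ?_ ?_
      · exact ((hv.comp (continuous_const.mul continuous_id)).enorm.measurable).pow_const _
      · filter_upwards [ae_restrict_mem measurableSet_Ioo] with t ht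
        have hmem : c ^ n * t ∈ Icc 0 T :=
          ⟨mul_nonneg (pow_nonneg hc.le n) ht.1.le,
            (mul_le_of_le_one_left ht.1.le (pow_le_one₀ hc.le (by linarith))).trans ht.2.le⟩
        rw [← ofReal_norm]
        gcongr
        exact hK _ hmem
      · simp [ENNReal.mul_eq_top, hq0.le, hq0]
      · refine Filter.Eventually.of_forall fun t => ?_
        have h2 : Filter.Tendsto (fun n : ℕ => c ^ n * t) Filter.atTop (nhds 0) := by
          simpa using (tendsto_pow_atTop_nhds_zero_of_lt_one hc.le (by linarith)).mul_const t
        have h3 : Continuous fun x => ‖v x‖ₑ ^ q := ENNReal.continuous_rpow_const.comp hv.enorm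
        simpa [hv0, hq0, Function.comp_def] using (h3.tendsto 0).comp h2
    simpa [hq0, hm, Function.comp_def] using
      ((ENNReal.continuous_rpow_const (y := 1 / q)).tendsto _).comp h1
  have hfin : ∀ n, m 0 ≤ (1 - r)⁻¹ * S + m n := by
    intro n
    refine (hsum n).trans ?_
    gcongr
    rw [← ENNReal.tsum_geometric]
    exact ENNReal.sum_le_tsum _
  have := ge_of_tendsto' (hlim.const_add ((1 - r)⁻¹ * S)) hfin
  simpa [hm] using this

/-- Hardy-type inequality: a continuous function vanishing at `0` is controlled in `L_q` by its
Gagliardo seminorm when `σ > 1 / q`. -/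
lemma lintegral_rpow_le_gagliardo {Y : Type*} [NormedAddCommGroup Y] {v : ℝ → Y}
    (hv : Continuous v) (hv0 : v 0 = 0) {q σ T : ℝ} (hq : 1 < q) (hσ : 1 / q < σ) (hT : 0 < T) :
    ∫⁻ t in Ioo 0 T, ‖v t‖ₑ ^ q ≤
      2 * (1 - ENNReal.ofReal ((1 / 2) ^ (σ - 1 / q)))⁻¹ ^ q * ENNReal.ofReal (T ^ (σ * q)) *
        ∫⁻ t in Ioo 0 T, ∫⁻ s in Ioo 0 T,
          ‖v t - v s‖ₑ ^ q / ENNReal.ofReal |t - s| ^ (1 + σ * q) := by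
  have hq0 : 0 < q := by linarith
  have hσ0 : 0 < σ := lt_trans (by positivity) hσ
  have hr : ENNReal.ofReal ((1 / 2) ^ (σ - 1 / q)) < 1 := by
    rw [ENNReal.ofReal_lt_one]
    exact Real.rpow_lt_one (by norm_num) (by norm_num) (by linarith)
  have hKtop : (1 - ENNReal.ofReal ((1 / 2) ^ (σ - 1 / q)))⁻¹ ≠ ⊤ :=
    ENNReal.inv_ne_top.2 (tsub_pos_of_lt hr).ne'
  set K := (1 - ENNReal.ofReal ((1 / 2) ^ (σ - 1 / q)))⁻¹
  set F : ℝ → ℝ → ℝ≥0∞ := fun c t => ‖v t - v (c * t)‖ₑ ^ q * ENNReal.ofReal (t ^ (-(σ * q)))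
    with hF
  set N := ∫⁻ t in Ioo 0 T, ‖v t‖ₑ ^ q with hN
  have h1 : ∀ c ∈ Ioo (0 : ℝ) (1 / 2),
      N ≤ K ^ q * ENNReal.ofReal (T ^ (σ * q)) * ∫⁻ t in Ioo 0 T, F c t := by
    intro c hc
    have h := lintegral_rpow_le_increment hv hv0 hq hσ hT hc.1 hc.2
    rw [one_div q, ENNReal.rpow_inv_le_iff hq0, ENNReal.mul_rpow_of_nonneg _ _ hq0.le,
      ENNReal.mul_rpow_of_nonneg _ _ hq0.le, ENNReal.rpow_inv_rpow hq0.ne',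
      ENNReal.ofReal_rpow_of_pos (by positivity), ← Real.rpow_mul hT.le, ← mul_assoc,
      ← one_div q] at h
    exact h
  have hFm : Measurable (Function.uncurry F) := by
    have h2 : Continuous fun p : ℝ × ℝ => v p.2 - v (p.1 * p.2) := by fun_prop
    have h3 : Measurable fun p : ℝ × ℝ => ENNReal.ofReal (p.2 ^ (-(σ * q))) := by fun_prop
    exact (h2.enorm.measurable.pow_const q).mul h3
  have h2 : ∫⁻ c in Ioo (0 : ℝ) (1 / 2), N ≤
      K ^ q * ENNReal.ofReal (T ^ (σ * q)) *
        ∫⁻ c in Ioo (0 : ℝ) (1 / 2), ∫⁻ t in Ioo 0 T, F c t := by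
    rw [← lintegral_const_mul']
    · exact setLIntegral_mono' measurableSet_Ioo h1
    · exact ENNReal.mul_ne_top (ENNReal.rpow_ne_top_of_nonneg hq0.le hKtop) ENNReal.ofReal_ne_top
  rw [lintegral_lintegral_swap hFm.aemeasurable] at h2
  have h3 : ∫⁻ t in Ioo 0 T, ∫⁻ c in Ioo (0 : ℝ) (1 / 2), F c t ≤
      ∫⁻ t in Ioo 0 T, ∫⁻ s in Ioo 0 T,
          ‖v t - v s‖ₑ ^ q / ENNReal.ofReal |t - s| ^ (1 + σ * q) := by
    refine setLIntegral_mono' measurableSet_Ioo fun t ht => ?_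
    have ht0 : 0 < t := ht.1
    have h4 := setLIntegral_Ioo_comp_mul_left
      (fun s => ‖v t - v s‖ₑ ^ q * ENNReal.ofReal (t ^ (-(σ * q)))) ht0 (1 / 2)
    simp only [hF, mul_comm _ t]
    rw [h4, ← lintegral_const_mul' _ _ ENNReal.ofReal_ne_top]
    refine (setLIntegral_mono' measurableSet_Ioo fun s hs => ?_).trans
      (lintegral_mono_set (Ioo_subset_Ioo_right (by linarith [ht.2] : t * (1 / 2) ≤ T)))
    have hts : 0 < t - s := by linarith [hs.2]
    rw [div_eq_mul_inv, mul_left_comm]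
    gcongr
    rw [abs_of_pos hts, ENNReal.ofReal_rpow_of_pos hts,
      ← ENNReal.ofReal_inv_of_pos (by positivity), ← ENNReal.ofReal_mul (by positivity)]
    refine ENNReal.ofReal_le_ofReal ?_
    rw [Real.rpow_neg ht0.le, ← mul_inv, ← Real.rpow_one_add' ht0.le (by positivity)]
    gcongr
    linarith [hs.1]
  have h5 : N = 2 * ∫⁻ c in Ioo (0 : ℝ) (1 / 2), N := by
    rw [setLIntegral_const, Real.volume_Ioo, sub_zero, mul_left_comm,
      show (2 : ℝ≥0∞) = ENNReal.ofReal 2 by simp, ← ENNReal.ofReal_mul (by norm_num)]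
    norm_num
  rw [h5]
  calc 2 * ∫⁻ c in Ioo (0 : ℝ) (1 / 2), N
      ≤ 2 * (K ^ q * ENNReal.ofReal (T ^ (σ * q)) * ∫⁻ t in Ioo 0 T, ∫⁻ s in Ioo 0 T,
          ‖v t - v s‖ₑ ^ q / ENNReal.ofReal |t - s| ^ (1 + σ * q)) := by
        gcongr
        exact h2.trans (by gcongr)
    _ = _ := by ring

lemma setLIntegral_Ioo_abs_sub_rpow_le {β t T : ℝ} (hβ : 0 < β) (ht : t ∈ Ioo 0 T) :
    ∫⁻ s in Ioo 0 T, ENNReal.ofReal (|t - s| ^ (β - 1)) ≤ ENNReal.ofReal (2 * T ^ β / β) := by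
  have hT : 0 < T := ht.1.trans ht.2
  set f : ℝ → ℝ≥0∞ := fun x => ENNReal.ofReal (|x| ^ (β - 1)) with hf
  have hpos : ∫⁻ x in Ioo 0 T, f x = ENNReal.ofReal (T ^ β / β) := by
    have hint : IntervalIntegrable (fun x : ℝ => x ^ (β - 1)) volume 0 T :=
      intervalIntegral.intervalIntegrable_rpow' (by linarith)
    have hval : ∫ x in (0 : ℝ)..T, x ^ (β - 1) = T ^ β / β := by
      rw [integral_rpow (Or.inl (by linarith))]
      simp [hβ.ne']
    rw [setLIntegral_congr Ioo_ae_eq_Ioc, ← hval, intervalIntegral.integral_of_le hT.le,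
      ofReal_integral_eq_lintegral_ofReal
        ((intervalIntegrable_iff_integrableOn_Ioc_of_le hT.le).1 hint)]
    · refine setLIntegral_congr_fun measurableSet_Ioc fun x hx => ?_
      simp only [hf, abs_of_pos hx.1]
    · filter_upwards [ae_restrict_mem measurableSet_Ioc] with x hx
      exact Real.rpow_nonneg hx.1.le _
  have hneg : ∫⁻ x in Ioo (-T) 0, f x = ∫⁻ x in Ioo 0 T, f x := by
    rw [← lintegral_indicator measurableSet_Ioo, ← lintegral_indicator measurableSet_Ioo,
      ← lintegral_neg_eq_self]
    refine lintegral_congr fun x => ?_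
    simp only [indicator, mem_Ioo, hf, abs_neg]
    congr 1
    simp [and_comm]
  have hsub : Ioo (-T) T ⊆ Ioo (-T) 0 ∪ {0} ∪ Ioo 0 T := by
    intro x hx
    rcases lt_trichotomy x 0 with h | h | h
    · exact Or.inl (Or.inl ⟨hx.1, h⟩)
    · exact Or.inl (Or.inr h)
    · exact Or.inr ⟨h, hx.2⟩
  calc ∫⁻ s in Ioo 0 T, ENNReal.ofReal (|t - s| ^ (β - 1))
      ≤ ∫⁻ s, (Ioo (-T) T).indicator f (t - s) := by
        rw [← lintegral_indicator measurableSet_Ioo]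
        refine lintegral_mono fun s => ?_
        by_cases hs : s ∈ Ioo 0 T
        · have : t - s ∈ Ioo (-T) T := ⟨by linarith [ht.1, hs.2], by linarith [ht.2, hs.1]⟩
          simp [hs, this, hf]
        · simp [hs]
    _ = ∫⁻ x in Ioo (-T) T, f x := by
        rw [lintegral_sub_left_eq_self, lintegral_indicator measurableSet_Ioo]
    _ ≤ (∫⁻ x in Ioo (-T) 0, f x) + (∫⁻ x in ({0} : Set ℝ), f x) + ∫⁻ x in Ioo 0 T, f x := by
        refine (lintegral_mono_set hsub).trans ((lintegral_union_le _ _ _).trans ?_)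
        gcongr
        exact lintegral_union_le _ _ _
    _ = ENNReal.ofReal (2 * T ^ β / β) := by
        rw [hneg, hpos, setLIntegral_measure_zero _ _ (by simp), add_zero,
          ← ENNReal.ofReal_add (by positivity) (by positivity)]
        congr 1
        ring

/-- Gagliardo seminorm of a function whose increments are dominated by those of `v` plus a
Hölder term. -/
lemma gagliardo_le_of_enorm_sub_le {Y Z : Type*} [NormedAddCommGroup Y] [NormedAddCommGroup Z]
    {v : ℝ → Y} (hv : Continuous v) {w : ℝ → Z} {q σ ρ T : ℝ} (hq : 1 < q)
    (hσρ : σ < ρ) {a b : ℝ≥0∞} (ha : a ≠ ⊤) (hb : b ≠ ⊤)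
    (hw : ∀ t ∈ Ioo 0 T, ∀ s ∈ Ioo 0 T,
      ‖w t - w s‖ₑ ≤ a * ‖v t - v s‖ₑ + b * ‖v t‖ₑ * ENNReal.ofReal |t - s| ^ ρ) :
    ∫⁻ t in Ioo 0 T, ∫⁻ s in Ioo 0 T, ‖w t - w s‖ₑ ^ q / ENNReal.ofReal |t - s| ^ (1 + σ * q) ≤
      2 ^ (q - 1) * (a ^ q * (∫⁻ t in Ioo 0 T, ∫⁻ s in Ioo 0 T,
          ‖v t - v s‖ₑ ^ q / ENNReal.ofReal |t - s| ^ (1 + σ * q)) +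
        b ^ q * ENNReal.ofReal (2 * T ^ ((ρ - σ) * q) / ((ρ - σ) * q)) *
          ∫⁻ t in Ioo 0 T, ‖v t‖ₑ ^ q) := by
  have hq0 : 0 < q := by linarith
  have hβ : 0 < (ρ - σ) * q := mul_pos (by linarith) hq0
  have haq : a ^ q ≠ ⊤ := ENNReal.rpow_ne_top_of_nonneg hq0.le ha
  have hbq : b ^ q ≠ ⊤ := ENNReal.rpow_ne_top_of_nonneg hq0.le hb
  have h2 : (2 : ℝ≥0∞) ^ (q - 1) ≠ ⊤ :=
    ENNReal.rpow_ne_top_of_nonneg (by linarith) (by simp)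
  set k : ℝ → ℝ → ℝ≥0∞ := fun t s => ‖v t - v s‖ₑ ^ q / ENNReal.ofReal |t - s| ^ (1 + σ * q)
    with hk
  have hkm : Measurable (Function.uncurry k) := by
    have h3 : Continuous fun p : ℝ × ℝ => v p.1 - v p.2 := by fun_prop
    have h4 : Measurable fun p : ℝ × ℝ => ENNReal.ofReal |p.1 - p.2| ^ (1 + σ * q) := by fun_prop
    exact (h3.enorm.measurable.pow_const q).div h4
  have hkt : ∀ t, Measurable fun s => a ^ q * k t s := fun t =>
    (hkm.comp measurable_prodMk_left).const_mul _
  have hkint : Measurable fun t => a ^ q * ∫⁻ s in Ioo 0 T, k t s :=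
    hkm.lintegral_prod_right'.const_mul _
  have hpt : ∀ t ∈ Ioo 0 T, ∀ s ∈ Ioo 0 T,
      ‖w t - w s‖ₑ ^ q / ENNReal.ofReal |t - s| ^ (1 + σ * q) ≤
        2 ^ (q - 1) * (a ^ q * k t s +
          b ^ q * ‖v t‖ₑ ^ q * ENNReal.ofReal (|t - s| ^ ((ρ - σ) * q - 1))) := by
    intro t ht s hs
    rcases eq_or_ne t s with rfl | hts
    · simp [hq0]
    have habs : 0 < |t - s| := abs_pos.2 (sub_ne_zero.2 hts)
    calc ‖w t - w s‖ₑ ^ q / ENNReal.ofReal |t - s| ^ (1 + σ * q)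
        ≤ (2 ^ (q - 1) * ((a * ‖v t - v s‖ₑ) ^ q +
            (b * ‖v t‖ₑ * ENNReal.ofReal |t - s| ^ ρ) ^ q)) /
              ENNReal.ofReal |t - s| ^ (1 + σ * q) := by
          gcongr
          exact (ENNReal.rpow_le_rpow (hw t ht s hs) hq0.le).trans
            (ENNReal.rpow_add_le_mul_rpow_add_rpow _ _ hq.le)
      _ = _ := by
          have hexp : ENNReal.ofReal (|t - s| ^ ((ρ - σ) * q - 1)) =
              (ENNReal.ofReal |t - s| ^ ρ) ^ q / ENNReal.ofReal |t - s| ^ (1 + σ * q) := by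
            rw [← ENNReal.ofReal_rpow_of_pos habs, ← ENNReal.rpow_mul,
              ← ENNReal.rpow_sub _ _ (by simpa [sub_eq_zero] using hts) ENNReal.ofReal_ne_top]
            congr 1
            ring
          rw [hexp, hk]
          simp only [ENNReal.mul_rpow_of_nonneg _ _ hq0.le, div_eq_mul_inv]
          ring
  have hinner : ∀ t ∈ Ioo 0 T,
      ∫⁻ s in Ioo 0 T, ‖w t - w s‖ₑ ^ q / ENNReal.ofReal |t - s| ^ (1 + σ * q) ≤
        2 ^ (q - 1) * (a ^ q * (∫⁻ s in Ioo 0 T, k t s) +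
          b ^ q * ENNReal.ofReal (2 * T ^ ((ρ - σ) * q) / ((ρ - σ) * q)) * ‖v t‖ₑ ^ q) := by
    intro t ht
    refine (setLIntegral_mono' measurableSet_Ioo (hpt t ht)).trans ?_
    rw [lintegral_const_mul' _ _ h2, lintegral_add_left (hkt t), lintegral_const_mul' _ _ haq,
      lintegral_const_mul' _ _ (ENNReal.mul_ne_top hbq
        (ENNReal.rpow_ne_top_of_nonneg hq0.le enorm_ne_top)), mul_right_comm (b ^ q)]
    gcongr
    exact setLIntegral_Ioo_abs_sub_rpow_le hβ ht
  refine (setLIntegral_mono' measurableSet_Ioo hinner).trans ?_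
  rw [lintegral_const_mul' _ _ h2, lintegral_add_left hkint,
    lintegral_const_mul' _ _ haq, lintegral_const_mul' _ _
      (ENNReal.mul_ne_top hbq ENNReal.ofReal_ne_top)]

lemma enorm_sub_le_cHolderNorm {X : Type*} [NormedAddCommGroup X] (u : ℝ → X) {ρ T t s : ℝ}
    (hρ : 0 < ρ) (ht : t ∈ Icc 0 T) (hs : s ∈ Icc 0 T) :
    ‖u t - u s‖ₑ ≤ cHolderNorm ρ T u * ENNReal.ofReal |t - s| ^ ρ := by
  rcases eq_or_ne t s with rfl | hts
  · simp
  have habs : 0 < |t - s| := abs_pos.2 (sub_ne_zero.2 hts)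
  have h : ‖u t - u s‖ₑ / ENNReal.ofReal |t - s| ^ ρ ≤ cHolderNorm ρ T u := by
    refine le_trans ?_ le_add_self
    exact le_iSup₂_of_le t ht (le_iSup₂_of_le s hs (le_iSup_of_le hts le_rfl))
  refine (ENNReal.div_le_iff ?_ ?_).1 h
  · simp [ENNReal.rpow_eq_zero_iff, sub_eq_zero, hts]
  · exact ENNReal.rpow_ne_top_of_nonneg hρ.le ENNReal.ofReal_ne_top

lemma wsNorm_eq_enorm {X : Type*} [NormedAddCommGroup X] (q σ T : ℝ) (u : ℝ → X) :
    wsNorm q σ T u = (∫⁻ t in Ioo (0:ℝ) T, ‖u t‖ₑ ^ q) ^ (1 / q) +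
      (∫⁻ t in Ioo (0:ℝ) T, ∫⁻ s in Ioo (0:ℝ) T,
        ‖u t - u s‖ₑ ^ q / ENNReal.ofReal |t - s| ^ (1 + σ * q)) ^ (1 / q) := rfl

lemma wsNorm_congr {X : Type*} [NormedAddCommGroup X] {q σ T : ℝ} {u w : ℝ → X}
    (h : EqOn u w (Ioo 0 T)) : wsNorm q σ T u = wsNorm q σ T w := by
  unfold wsNorm
  congr 2
  · exact setLIntegral_congr_fun measurableSet_Ioo fun t ht => by simp only [h ht]
  · refine setLIntegral_congr_fun measurableSet_Ioo fun t ht => ?_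
    exact setLIntegral_congr_fun measurableSet_Ioo fun s hs => by simp only [h ht, h hs]

lemma wsNorm_bilin_le {X Y Z : Type*} [NormedAddCommGroup X] [NormedSpace ℝ X]
    [NormedAddCommGroup Y] [NormedSpace ℝ Y] [NormedAddCommGroup Z] [NormedSpace ℝ Z]
    (B : X →ₗ[ℝ] Y →ₗ[ℝ] Z) {M : ℝ} (hB : ∀ x y, ‖B x y‖ ≤ M * ‖x‖ * ‖y‖)
    {q ρ σ : ℝ} (hq : 1 < q) (hσ : 1 / q < σ) (hσρ : σ < ρ) :
    ∃ C : ℝ≥0∞, C ≠ ⊤ ∧ ∀ T > (0 : ℝ), ∀ u : ℝ → X, ∀ v : ℝ → Y,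
      cHolderNorm ρ T u ≠ ⊤ → u 0 = 0 → Continuous v → v 0 = 0 →
      wsNorm q σ T (fun t => B (u t) (v t)) ≤
        C * (ENNReal.ofReal (T ^ ρ) * cHolderNorm ρ T u * wsNorm q σ T v) := by
  have hq0 : 0 < q := by linarith
  have hσ0 : 0 < σ := lt_trans (by positivity) hσ
  have hρ0 : 0 < ρ := hσ0.trans hσρ
  have hβ : 0 < (ρ - σ) * q := mul_pos (by linarith) hq0
  have hr : ENNReal.ofReal ((1 / 2) ^ (σ - 1 / q)) < 1 := by
    rw [ENNReal.ofReal_lt_one]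
    exact Real.rpow_lt_one (by norm_num) (by norm_num) (by linarith)
  have hBe : ∀ x y, ‖B x y‖ₑ ≤ ENNReal.ofReal M * ‖x‖ₑ * ‖y‖ₑ := by
    intro x y
    rw [← ofReal_norm, ← ofReal_norm, ← ofReal_norm, ← ENNReal.ofReal_mul' (norm_nonneg _),
      ← ENNReal.ofReal_mul' (norm_nonneg _)]
    exact ENNReal.ofReal_le_ofReal (hB x y)
  set K2 : ℝ≥0∞ := 2 * (1 - ENNReal.ofReal ((1 / 2) ^ (σ - 1 / q)))⁻¹ ^ q with hK2
  have hK2top : K2 ≠ ⊤ := ENNReal.mul_ne_top (by simp) (ENNReal.rpow_ne_top_of_nonneg hq0.le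
    (ENNReal.inv_ne_top.2 (tsub_pos_of_lt hr).ne'))
  set L : ℝ≥0∞ := 1 + 2 ^ (q - 1) * (1 + ENNReal.ofReal (2 / ((ρ - σ) * q)) * K2) with hL
  have hLtop : L ≠ ⊤ := ENNReal.add_ne_top.2 ⟨by simp, ENNReal.mul_ne_top
    (ENNReal.rpow_ne_top_of_nonneg (by linarith) (by simp))
    (ENNReal.add_ne_top.2 ⟨by simp, ENNReal.mul_ne_top ENNReal.ofReal_ne_top hK2top⟩)⟩
  refine ⟨ENNReal.ofReal M * L ^ (1 / q), ENNReal.mul_ne_top ENNReal.ofReal_ne_top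
    (ENNReal.rpow_ne_top_of_nonneg (by positivity) hLtop), fun T hT u v hH hu0 hv hv0 => ?_⟩
  set H := cHolderNorm ρ T u
  have hu : ∀ t ∈ Ioo 0 T, ‖u t‖ₑ ≤ H * ENNReal.ofReal (T ^ ρ) := by
    intro t ht
    have h := enorm_sub_le_cHolderNorm u hρ0 (Ioo_subset_Icc_self ht)
      (left_mem_Icc.2 hT.le)
    rw [hu0, sub_zero, sub_zero, abs_of_pos ht.1] at h
    refine h.trans ?_
    rw [← ENNReal.ofReal_rpow_of_pos hT]
    gcongr
    exact ht.2.le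
  set b := ENNReal.ofReal M * H with hb
  set a := b * ENNReal.ofReal (T ^ ρ) with ha
  have hbtop : b ≠ ⊤ := ENNReal.mul_ne_top ENNReal.ofReal_ne_top hH
  have hatop : a ≠ ⊤ := ENNReal.mul_ne_top hbtop ENNReal.ofReal_ne_top
  have hP : ∫⁻ t in Ioo 0 T, ‖B (u t) (v t)‖ₑ ^ q ≤ a ^ q * ∫⁻ t in Ioo 0 T, ‖v t‖ₑ ^ q := by
    rw [← lintegral_const_mul' _ _ (ENNReal.rpow_ne_top_of_nonneg hq0.le hatop)]
    refine setLIntegral_mono' measurableSet_Ioo fun t ht => ?_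
    rw [← ENNReal.mul_rpow_of_nonneg _ _ hq0.le, ha, hb]
    refine ENNReal.rpow_le_rpow ((hBe _ _).trans ?_) hq0.le
    rw [mul_assoc (ENNReal.ofReal M) H]
    gcongr
    exact hu t ht
  have hQ := gagliardo_le_of_enorm_sub_le hv (w := fun t => B (u t) (v t)) (T := T) hq hσρ
    hatop hbtop (by
      intro t ht s hs
      have hsplit : B (u t) (v t) - B (u s) (v s) =
          B (u s) (v t - v s) + B (u t - u s) (v t) := by
        simp
      rw [hsplit]
      refine (enorm_add_le _ _).trans (add_le_add ?_ ?_)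
      · refine (hBe _ _).trans ?_
        rw [ha, hb, mul_assoc (ENNReal.ofReal M) H]
        gcongr
        exact hu s hs
      · refine (hBe _ _).trans ?_
        rw [hb, mul_right_comm, mul_right_comm (_ * H), mul_assoc (ENNReal.ofReal M) H,
          mul_right_comm]
        gcongr
        exact enorm_sub_le_cHolderNorm u hρ0 (Ioo_subset_Icc_self ht) (Ioo_subset_Icc_self hs))
  have hN := lintegral_rpow_le_gagliardo hv hv0 hq hσ hT
  rw [wsNorm_eq_enorm, wsNorm_eq_enorm]
  set N := ∫⁻ t in Ioo 0 T, ‖v t‖ₑ ^ q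
  set D := ∫⁻ t in Ioo 0 T, ∫⁻ s in Ioo 0 T,
    ‖v t - v s‖ₑ ^ q / ENNReal.ofReal |t - s| ^ (1 + σ * q)
  have hpow : ENNReal.ofReal (2 * T ^ ((ρ - σ) * q) / ((ρ - σ) * q)) *
      ENNReal.ofReal (T ^ (σ * q)) =
        ENNReal.ofReal (2 / ((ρ - σ) * q)) * ENNReal.ofReal (T ^ ρ) ^ q := by
    rw [ENNReal.ofReal_rpow_of_pos (by positivity), ← ENNReal.ofReal_mul (by positivity),
      ← ENNReal.ofReal_mul (by positivity), ← Real.rpow_mul hT.le,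
      show ρ * q = (ρ - σ) * q + σ * q by ring, Real.rpow_add hT]
    congr 1
    ring
  have hQ' : 2 ^ (q - 1) * (a ^ q * D +
      b ^ q * ENNReal.ofReal (2 * T ^ ((ρ - σ) * q) / ((ρ - σ) * q)) * N) ≤ L * (a ^ q * D) := by
    calc _ ≤ 2 ^ (q - 1) * (a ^ q * D +
          b ^ q * ENNReal.ofReal (2 * T ^ ((ρ - σ) * q) / ((ρ - σ) * q)) *
            (K2 * ENNReal.ofReal (T ^ (σ * q)) * D)) := by gcongr
      _ = 2 ^ (q - 1) * (a ^ q * D + b ^ q *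
          (ENNReal.ofReal (2 * T ^ ((ρ - σ) * q) / ((ρ - σ) * q)) *
            ENNReal.ofReal (T ^ (σ * q))) * (K2 * D)) := by ring
      _ = 2 ^ (q - 1) * (1 + ENNReal.ofReal (2 / ((ρ - σ) * q)) * K2) * (a ^ q * D) := by
        rw [hpow, ha, ENNReal.mul_rpow_of_nonneg _ _ hq0.le]
        ring
      _ ≤ L * (a ^ q * D) := by
        gcongr
        exact le_add_self
  have hP' : a ^ q * N ≤ L * (a ^ q * N) :=
    le_mul_of_one_le_left zero_le le_self_add
  have hroot : ∀ x : ℝ≥0∞, (L * (a ^ q * x)) ^ (1 / q) = L ^ (1 / q) * (a * x ^ (1 / q)) := by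
    intro x
    rw [ENNReal.mul_rpow_of_nonneg _ _ (by positivity),
      ENNReal.mul_rpow_of_nonneg _ _ (by positivity), one_div, ENNReal.rpow_rpow_inv hq0.ne']
  calc _ ≤ (L * (a ^ q * N)) ^ (1 / q) + (L * (a ^ q * D)) ^ (1 / q) := by
        gcongr
        · exact hP.trans hP'
        · exact hQ.trans hQ'
    _ = _ := by
        rw [hroot, hroot, ha, hb]
        ring

theorem statement8 {X Y Z : Type*}
    [NormedAddCommGroup X] [NormedSpace ℝ X] [CompleteSpace X]
    [NormedAddCommGroup Y] [NormedSpace ℝ Y] [CompleteSpace Y]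
    [NormedAddCommGroup Z] [NormedSpace ℝ Z] [CompleteSpace Z]
    (B : X →ₗ[ℝ] Y →ₗ[ℝ] Z) (M : ℝ) (hB : ∀ x y, ‖B x y‖ ≤ M * ‖x‖ * ‖y‖)
    (q ρ σ ε : ℝ) (hq : 1 < q) (hσ : 1 / q < σ) (hσρ : σ < ρ) (hρ : ρ < 1)
    (hε0 : 0 ≤ ε) (hε1 : ε < σ - 1 / q) :
    ∃ C > (0 : ℝ), ∀ T > (0 : ℝ), ∀ u : ℝ → X, ∀ v : ℝ → Y,
      cHolderNorm ρ T u < ⊤ → u 0 = 0 →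
      ContinuousOn v (Icc (0:ℝ) T) → v 0 = 0 → wsNorm q σ T v < ⊤ →
      wsNorm q σ T (fun t => B (u t) (v t)) ≤
        ENNReal.ofReal C *
          (ENNReal.ofReal (T ^ ρ) * cHolderNorm ρ T u * wsNorm q σ T v +
            ENNReal.ofReal (T ^ (ρ + ε - σ + 1 / q)) * wsNorm q σ T v * cHolderNorm ρ T u) := by
  obtain ⟨C, hC, hmain⟩ := wsNorm_bilin_le B hB hq hσ hσρ
  refine ⟨C.toReal + 1, by positivity, fun T hT u v hH hu0 hv hv0 _ => ?_⟩
  set w : ℝ → Y := IccExtend hT.le ((Icc 0 T).domRestrict v)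
  have hw : Continuous w := hv.domRestrict.Icc_extend'
  have hwv : EqOn w v (Icc 0 T) := fun t ht => IccExtend_of_mem _ _ ht
  have hwv' : EqOn w v (Ioo 0 T) := hwv.mono Ioo_subset_Icc_self
  have h := hmain T hT u w hH.ne hu0 hw ((hwv (left_mem_Icc.2 hT.le)).trans hv0)
  rw [wsNorm_congr hwv', wsNorm_congr (fun t ht => by simp only [hwv' ht] :
    EqOn (fun t => B (u t) (w t)) (fun t => B (u t) (v t)) (Ioo 0 T))] at h
  refine h.trans (mul_le_mul' ?_ le_self_add)
  rw [ENNReal.le_ofReal_iff_toReal_le hC (by positivity)]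
  linarith
end

section
/- Let q ∈ (1,∞), δ ∈ [0,1), and σ ∈ (0,1) with 1/q + δ < σ, and let X be a Banach space. There is a constant C = C(q,σ,δ) > 0 such that for every T ∈ (0,∞] and every continuous u : [0,T) → X with u(0) = 0 and ‖u‖_{W_q^σ((0,T),X)} < ∞, one has sup_{t∈[0,T)} ‖u(t)‖_X + sup_{s≠t} ‖u(t)−u(s)‖_X/|t−s|^δ ≤ C·‖u‖_{W_q^σ((0,T),X)}; in particular the constant does not depend on T. -/
open MeasureTheory Set ENNReal

/-- The time interval `(0,T)` for `T ∈ (0,∞]` (with `T : ℝ≥0∞`), as a subset of `ℝ`. -/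
def timeSet (T : ℝ≥0∞) : Set ℝ := {t : ℝ | 0 < t ∧ ENNReal.ofReal t < T}

/-- The `W_q^σ((0,T),X)` Sobolev–Slobodeckii norm over a time set `J`, valued in `ℝ≥0∞`. -/
noncomputable def wsNormSet {X : Type*} [NormedAddCommGroup X] (q σ : ℝ) (J : Set ℝ)
    (u : ℝ → X) : ℝ≥0∞ :=
  (∫⁻ t in J, (‖u t‖₊ : ℝ≥0∞) ^ q) ^ (1 / q) +
    (∫⁻ t in J, ∫⁻ s in J,
        (‖u t - u s‖₊ : ℝ≥0∞) ^ q / (ENNReal.ofReal |t - s|) ^ (1 + σ * q)) ^ (1 / q)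

lemma lintegral_cond {α : Type*} [MeasurableSpace α] (μ : Measure α) (s : Set α)
    (f : α → ℝ≥0∞) : ∫⁻ x, f x ∂(ProbabilityTheory.cond μ s) = (μ s)⁻¹ * ∫⁻ x in s, f x ∂μ := by
  rw [ProbabilityTheory.cond, lintegral_smul_measure, smul_eq_mul]

/-- Young's inequality in the form used to avoid Jensen's inequality. -/
lemma le_add_rpow_mul_rpow {q l : ℝ} (hq : 1 < q) (hl : 0 < l) (x : ℝ≥0∞) :
    x ≤ ENNReal.ofReal l + ENNReal.ofReal (l ^ (1 - q)) * x ^ q := by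
  rcases le_total x (ENNReal.ofReal l) with h | h
  · exact h.trans le_self_add
  · refine le_trans ?_ le_add_self
    have h0 : ENNReal.ofReal l ≠ 0 := by simpa using hl
    have hx : x ≠ 0 := fun hx => h0 (by simpa [hx] using h)
    calc x = ENNReal.ofReal (l ^ (1 - q)) * (ENNReal.ofReal l ^ (q - 1) * x) := by
            rw [← mul_assoc, ENNReal.ofReal_rpow_of_pos hl, ← ENNReal.ofReal_mul (by positivity),
              ← Real.rpow_add hl]
            simp
      _ ≤ ENNReal.ofReal (l ^ (1 - q)) * (x ^ (q - 1) * x) := by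
            gcongr
      _ = ENNReal.ofReal (l ^ (1 - q)) * x ^ q := by
            congr 1
            by_cases hxt : x = ⊤
            · rw [hxt, ENNReal.top_rpow_of_pos (by linarith), ENNReal.top_rpow_of_pos (by linarith)]
              simp
            · nth_rewrite 2 [← ENNReal.rpow_one x]
              rw [← ENNReal.rpow_add _ _ hx hxt]
              simp

section

variable {X : Type*} [NormedAddCommGroup X]

lemma lintegral_enorm_sub_le {α : Type*} [MeasurableSpace α] (μ ν : Measure α)
    [IsProbabilityMeasure μ] [IsProbabilityMeasure ν] (u : α → X) (x : X)
    (hu : AEMeasurable (fun s => ‖u s - x‖ₑ) ν) :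
    ∫⁻ t, ‖u t - x‖ₑ ∂μ ≤ (∫⁻ t, ∫⁻ s, ‖u t - u s‖ₑ ∂ν ∂μ) + ∫⁻ s, ‖u s - x‖ₑ ∂ν := by
  have h (t : α) : ‖u t - x‖ₑ ≤ (∫⁻ s, ‖u t - u s‖ₑ ∂ν) + ∫⁻ s, ‖u s - x‖ₑ ∂ν := by
    rw [← lintegral_add_right' _ hu]
    calc ‖u t - x‖ₑ = ∫⁻ _, ‖u t - x‖ₑ ∂ν := by simp
      _ ≤ _ := lintegral_mono fun s => by
        simpa using enorm_add_le (u t - u s) (u s - x)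
  calc _ ≤ ∫⁻ t, ((∫⁻ s, ‖u t - u s‖ₑ ∂ν) + ∫⁻ s, ‖u s - x‖ₑ ∂ν) ∂μ := lintegral_mono h
    _ = _ := by
      rw [lintegral_add_right _ measurable_const]
      simp

/-- The average oscillation of `u` between two intervals of length comparable to their distance. -/
lemma lintegral_cond_enorm_sub_le {q σ M d : ℝ} (hq : 1 < q) (hσ : 0 < σ) (hM : 0 < M) (hd : 0 < d)
    {u : ℝ → X} {J I I' : Set ℝ} (hI : MeasurableSet I) (hI' : MeasurableSet I')
    (hIJ : I ⊆ J) (hIJ' : I' ⊆ J)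
    (hvol : volume I = ENNReal.ofReal d) (hvol' : volume I' = ENNReal.ofReal (d / 2))
    (hdist : ∀ t ∈ I, ∀ s ∈ I', |t - s| ≤ d)
    (hu : ∫⁻ t in J, ∫⁻ s in J, ‖u t - u s‖ₑ ^ q / (ENNReal.ofReal |t - s|) ^ (1 + σ * q)
      ≤ ENNReal.ofReal (M ^ q)) :
    ∫⁻ t, ∫⁻ s, ‖u t - u s‖ₑ ∂(ProbabilityTheory.cond volume I')
      ∂(ProbabilityTheory.cond volume I) ≤ ENNReal.ofReal (3 * M * d ^ (σ - 1 / q)) := by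
  set l := M * d ^ (σ - 1 / q) with hl
  have hl0 : 0 < l := by positivity
  set c := l ^ (1 - q) * d ^ (1 + σ * q) with hc
  have hc0 : 0 < c := by positivity
  set K : ℝ → ℝ → ℝ≥0∞ := fun t s =>
    ‖u t - u s‖ₑ ^ q / (ENNReal.ofReal |t - s|) ^ (1 + σ * q) with hK
  have hp : 0 < 1 + σ * q := by positivity
  have : IsProbabilityMeasure (ProbabilityTheory.cond volume I) :=
    ProbabilityTheory.cond_isProbabilityMeasure_of_finite (by simp [hvol, hd]) (by simp [hvol])
  have : IsProbabilityMeasure (ProbabilityTheory.cond volume I') :=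
    ProbabilityTheory.cond_isProbabilityMeasure_of_finite (by simp [hvol', hd]) (by simp [hvol'])
  have hpt : ∀ t ∈ I, ∀ s ∈ I', ‖u t - u s‖ₑ ≤ ENNReal.ofReal l + ENNReal.ofReal c * K t s := by
    intro t ht s hs
    refine (le_add_rpow_mul_rpow hq hl0 _).trans ?_
    rw [hc, ENNReal.ofReal_mul (p := l ^ (1 - q)) (by positivity), mul_assoc]
    gcongr
    rcases eq_or_ne t s with rfl | hts
    · simp [(zero_lt_one.trans hq)]
    · calc ‖u t - u s‖ₑ ^ q = ENNReal.ofReal |t - s| ^ (1 + σ * q) * K t s := by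
            rw [hK, ENNReal.mul_div_cancel]
            · simp [hts, sub_eq_zero]
            · simp [hp.le]
        _ ≤ _ := by
          rw [← ENNReal.ofReal_rpow_of_pos hd]
          gcongr
          exact hdist t ht s hs
  have hin : ∀ t ∈ I, ∫⁻ s, ‖u t - u s‖ₑ ∂(ProbabilityTheory.cond volume I') ≤
      ENNReal.ofReal l + ENNReal.ofReal c * ((ENNReal.ofReal (d / 2))⁻¹ * ∫⁻ s in J, K t s) := by
    intro t ht
    calc _ ≤ ∫⁻ s, (ENNReal.ofReal l + ENNReal.ofReal c * K t s)
            ∂(ProbabilityTheory.cond volume I') := by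
          refine lintegral_mono_ae ?_
          filter_upwards [ProbabilityTheory.ae_cond_mem hI'] with s hs using hpt t ht s hs
      _ = ENNReal.ofReal l + ENNReal.ofReal c *
            ((ENNReal.ofReal (d / 2))⁻¹ * ∫⁻ s in I', K t s) := by
          rw [lintegral_add_left measurable_const, lintegral_const, measure_univ, mul_one,
            lintegral_const_mul' _ _ (by simp), lintegral_cond, hvol']
      _ ≤ _ := by
          gcongr
  have hinv : (ENNReal.ofReal (d / 2))⁻¹ ≠ ⊤ := by simp [hd]
  calc _ ≤ ∫⁻ t, (ENNReal.ofReal l + ENNReal.ofReal c *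
            ((ENNReal.ofReal (d / 2))⁻¹ * ∫⁻ s in J, K t s))
            ∂(ProbabilityTheory.cond volume I) := by
          refine lintegral_mono_ae ?_
          filter_upwards [ProbabilityTheory.ae_cond_mem hI] with t ht using hin t ht
    _ = ENNReal.ofReal l + ENNReal.ofReal c * ((ENNReal.ofReal (d / 2))⁻¹ *
          ((ENNReal.ofReal d)⁻¹ * ∫⁻ t in I, ∫⁻ s in J, K t s)) := by
          rw [lintegral_add_left measurable_const, lintegral_const, measure_univ, mul_one,
            lintegral_const_mul' _ _ (by simp), lintegral_const_mul' _ _ hinv, lintegral_cond, hvol]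
    _ ≤ ENNReal.ofReal l + ENNReal.ofReal c * ((ENNReal.ofReal (d / 2))⁻¹ *
          ((ENNReal.ofReal d)⁻¹ * ENNReal.ofReal (M ^ q))) := by
          gcongr
          exact (lintegral_mono_set hIJ).trans hu
    _ = ENNReal.ofReal (l + c * ((d / 2)⁻¹ * (d⁻¹ * M ^ q))) := by
          rw [← ENNReal.ofReal_inv_of_pos hd, ← ENNReal.ofReal_inv_of_pos (half_pos hd),
            ← ENNReal.ofReal_mul (by positivity), ← ENNReal.ofReal_mul (by positivity),
            ← ENNReal.ofReal_mul (by positivity), ← ENNReal.ofReal_add (by positivity)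
              (by positivity)]
    _ = _ := by
          congr 1
          have h1 : d ^ (1 + σ * q) * (d⁻¹ * d⁻¹) * M ^ q = l ^ q := by
            rw [hl, Real.mul_rpow hM.le (by positivity), ← Real.rpow_mul hd.le,
              ← Real.rpow_neg_one, ← Real.rpow_add hd, ← Real.rpow_add hd, mul_comm]
            congr 2
            field_simp
            ring
          have h2 : l ^ (1 - q) * l ^ q = l := by
            rw [← Real.rpow_add hl0]; simp
          calc l + c * ((d / 2)⁻¹ * (d⁻¹ * M ^ q))
              = l + 2 * (l ^ (1 - q) * (d ^ (1 + σ * q) * (d⁻¹ * d⁻¹) * M ^ q)) := by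
                rw [hc, inv_div]; ring
            _ = 3 * M * d ^ (σ - 1 / q) := by
                rw [h1, h2, hl]; ring

/-- Telescoping the average oscillation along intervals shrinking dyadically to a point `a`. -/
lemma lintegral_cond_enorm_sub_le_of_dyadic {q σ M h : ℝ} (hq : 1 < q) (hσ : 0 < σ)
    (hα : 0 < σ - 1 / q) (hM : 0 < M) (hh : 0 < h) {u : ℝ → X} {J S : Set ℝ} {I : ℕ → Set ℝ}
    {a : ℝ} (hJS : J ⊆ S) (hcont : ContinuousOn u S) (ha : a ∈ S)
    (hI : ∀ n, MeasurableSet (I n)) (hIJ : ∀ n, I n ⊆ J)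
    (hvol : ∀ n, volume (I n) = ENNReal.ofReal (h * (1 / 2) ^ n))
    (hdist : ∀ n, ∀ t ∈ I n, ∀ s ∈ I (n + 1), |t - s| ≤ h * (1 / 2) ^ n)
    (hdist' : ∀ n, ∀ t ∈ I n, |t - a| ≤ h * (1 / 2) ^ n)
    (hu : ∫⁻ t in J, ∫⁻ s in J, ‖u t - u s‖ₑ ^ q / (ENNReal.ofReal |t - s|) ^ (1 + σ * q)
      ≤ ENNReal.ofReal (M ^ q)) :
    ∫⁻ t, ‖u t - u a‖ₑ ∂(ProbabilityTheory.cond volume (I 0)) ≤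
      ENNReal.ofReal (3 / (1 - (1 / 2) ^ (σ - 1 / q)) * M * h ^ (σ - 1 / q)) := by
  set α := σ - 1 / q with hα'
  set r : ℝ := (1 / 2) ^ α with hr
  have hr0 : 0 < r := by positivity
  have hr1 : r < 1 := Real.rpow_lt_one (by norm_num) (by norm_num) hα
  have hr1' : 0 < 1 - r := by linarith
  set B := 3 / (1 - r) * M * h ^ α with hB
  have hB0 : 0 < B := by positivity
  have hprob (n : ℕ) : IsProbabilityMeasure (ProbabilityTheory.cond volume (I n)) :=
    ProbabilityTheory.cond_isProbabilityMeasure_of_finite (by simp [hvol, hh]) (by simp [hvol])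
  set A : ℕ → ℝ≥0∞ := fun n => ∫⁻ t, ‖u t - u a‖ₑ ∂(ProbabilityTheory.cond volume (I n)) with hA
  have hmeas (n : ℕ) :
      AEMeasurable (fun s => ‖u s - u a‖ₑ) (ProbabilityTheory.cond volume (I n)) := by
    have hc : ContinuousOn (fun s => ‖u s - u a‖ₑ) (I n) :=
      ((hcont.mono ((hIJ n).trans hJS)).sub continuousOn_const).enorm
    exact (hc.aemeasurable (hI n)).smul_measure _
  have hpow (n : ℕ) : (h * (1 / 2 : ℝ) ^ n) ^ α = h ^ α * r ^ n := by
    rw [Real.mul_rpow hh.le (by positivity), hr, ← Real.rpow_natCast, ← Real.rpow_natCast,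
      ← Real.rpow_mul (by norm_num), ← Real.rpow_mul (by norm_num), mul_comm α]
  have hstep (n : ℕ) : A n ≤ ENNReal.ofReal (B * (r ^ n - r ^ (n + 1))) + A (n + 1) := by
    refine (lintegral_enorm_sub_le _ (ProbabilityTheory.cond volume (I (n + 1))) u (u a)
      (hmeas _)).trans ?_
    gcongr
    refine (lintegral_cond_enorm_sub_le hq hσ hM (d := h * (1 / 2) ^ n) (by positivity) (hI n)
      (hI (n + 1)) (hIJ n) (hIJ _) (hvol n) ?_ (hdist n) hu).trans (le_of_eq ?_)
    · rw [hvol]; congr 1; ring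
    · rw [← hα', hpow, hB]
      congr 1
      field_simp
      ring
  have hsum (n : ℕ) : A 0 ≤ ENNReal.ofReal (B * (1 - r ^ n)) + A n := by
    induction n with
    | zero => simp
    | succ n ih =>
      refine ih.trans ((add_le_add_right (hstep n) _).trans (le_of_eq ?_))
      rw [← add_assoc, ← ENNReal.ofReal_add]
      · congr 2; ring
      · have := pow_le_one₀ (n := n) hr0.le hr1.le
        exact mul_nonneg hB0.le (by linarith)
      · have := pow_le_pow_of_le_one hr0.le hr1.le (Nat.le_succ n)
        exact mul_nonneg hB0.le (by simpa using this)
  refine ENNReal.le_of_forall_pos_le_add fun ε hε _ => ?_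
  obtain ⟨δ, hδ, hδu⟩ := Metric.continuousOn_iff.1 hcont a ha ε (by exact_mod_cast hε)
  obtain ⟨n, hn⟩ := exists_pow_lt_of_lt_one (div_pos hδ hh) (by norm_num : (1 / 2 : ℝ) < 1)
  have hAn : A n ≤ ε := by
    calc A n ≤ ∫⁻ _, (ε : ℝ≥0∞) ∂(ProbabilityTheory.cond volume (I n)) := by
          refine lintegral_mono_ae ?_
          filter_upwards [ProbabilityTheory.ae_cond_mem (hI n)] with t ht
          have h1 : dist t a < δ := by
            rw [Real.dist_eq]
            refine (hdist' n t ht).trans_lt ?_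
            rw [lt_div_iff₀ hh] at hn
            linarith
          have h2 := (hδu t (hJS (hIJ n ht)) h1).le
          rw [dist_eq_norm] at h2
          rw [enorm_eq_nnnorm]
          exact_mod_cast h2
      _ = ε := by simp
  refine (hsum n).trans (add_le_add (ENNReal.ofReal_le_ofReal ?_) hAn)
  have : 0 < r ^ n := by positivity
  nlinarith

/-- Morrey's inequality with a scale-invariant constant. -/
lemma enorm_sub_le_of_seminorm_le {q σ M : ℝ} (hq : 1 < q) (hσ : 0 < σ)
    (hα : 0 < σ - 1 / q) (hM : 0 < M) {u : ℝ → X} {J S : Set ℝ} {a b : ℝ} (hab : a < b)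
    (hJS : J ⊆ S) (hcont : ContinuousOn u S) (ha : a ∈ S) (hb : b ∈ S) (hJ : Ioo a b ⊆ J)
    (hu : ∫⁻ t in J, ∫⁻ s in J, ‖u t - u s‖ₑ ^ q / (ENNReal.ofReal |t - s|) ^ (1 + σ * q)
      ≤ ENNReal.ofReal (M ^ q)) :
    ‖u a - u b‖ₑ ≤
      ENNReal.ofReal (6 / (1 - (1 / 2) ^ (σ - 1 / q)) * M * (b - a) ^ (σ - 1 / q)) := by
  have hr1 : 0 < 1 - (1 / 2 : ℝ) ^ (σ - 1 / q) :=
    sub_pos.2 (Real.rpow_lt_one (by norm_num) (by norm_num) hα)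
  set h := b - a with hh'
  have hh : 0 < h := sub_pos.2 hab
  have hle (n : ℕ) : h * (1 / 2 : ℝ) ^ n ≤ h :=
    mul_le_of_le_one_right hh.le (pow_le_one₀ (by norm_num) (by norm_num))
  have hsucc (n : ℕ) : h * (1 / 2 : ℝ) ^ (n + 1) ≤ h * (1 / 2 : ℝ) ^ n := by
    gcongr h * ?_
    exact pow_le_pow_of_le_one (by norm_num) (by norm_num) n.le_succ
  have hA := lintegral_cond_enorm_sub_le_of_dyadic hq hσ hα hM hh
    (I := fun n => Ioo a (a + h * (1 / 2) ^ n)) hJS hcont ha (fun _ => measurableSet_Ioo)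
    (fun n => (Ioo_subset_Ioo_right (by linarith [hle n])).trans hJ) (fun n => by simp)
    (fun n t ht s hs => by
      rw [abs_le]; constructor <;> linarith [ht.1, ht.2, hs.1, hs.2, hsucc n])
    (fun n t ht => by rw [abs_le]; constructor <;> linarith [ht.1, ht.2]) hu
  have hB := lintegral_cond_enorm_sub_le_of_dyadic hq hσ hα hM hh
    (I := fun n => Ioo (b - h * (1 / 2) ^ n) b) hJS hcont hb (fun _ => measurableSet_Ioo)
    (fun n => (Ioo_subset_Ioo_left (by linarith [hle n])).trans hJ) (fun n => by simp)
    (fun n t ht s hs => by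
      rw [abs_le]; constructor <;> linarith [ht.1, ht.2, hs.1, hs.2, hsucc n])
    (fun n t ht => by rw [abs_le]; constructor <;> linarith [ht.1, ht.2]) hu
  have e1 : a + h * (1 / 2) ^ 0 = b := by simp [hh']
  have e2 : b - h * (1 / 2) ^ 0 = a := by simp [hh']
  simp only [e1] at hA
  simp only [e2] at hB
  have : IsProbabilityMeasure (ProbabilityTheory.cond volume (Ioo a b)) :=
    ProbabilityTheory.cond_isProbabilityMeasure_of_finite (by simp [hab]) (by simp)
  have hmeas : AEMeasurable (fun s => ‖u s - u a‖ₑ)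
      (ProbabilityTheory.cond volume (Ioo a b)) := by
    have hc : ContinuousOn (fun s => ‖u s - u a‖ₑ) (Ioo a b) :=
      ((hcont.mono (hJ.trans hJS)).sub continuousOn_const).enorm
    exact (hc.aemeasurable measurableSet_Ioo).smul_measure _
  calc ‖u a - u b‖ₑ = ∫⁻ _, ‖u a - u b‖ₑ ∂(ProbabilityTheory.cond volume (Ioo a b)) := by simp
    _ ≤ ∫⁻ t, (‖u t - u a‖ₑ + ‖u t - u b‖ₑ) ∂(ProbabilityTheory.cond volume (Ioo a b)) :=
        lintegral_mono fun t => by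
          rw [← enorm_neg (u t - u a), neg_sub]
          simpa using enorm_add_le (u a - u t) (u t - u b)
    _ ≤ _ := by
        rw [lintegral_add_left' hmeas]
        refine (add_le_add hA hB).trans (le_of_eq ?_)
        rw [← ENNReal.ofReal_add (by positivity) (by positivity)]
        congr 1
        ring

/-- On an interval of length one, `‖u‖` attains values not exceeding an `L^q` bound. -/
lemma exists_enorm_le_of_lintegral_rpow_lt {q : ℝ} (hq : 0 < q) {m : ℝ≥0∞} {u : ℝ → X}
    {J : Set ℝ} {a : ℝ} (hJ : Ioo a (a + 1) ⊆ J) (hu : ∫⁻ t in J, ‖u t‖ₑ ^ q < m ^ q) :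
    ∃ r ∈ Ioo a (a + 1), ‖u r‖ₑ ≤ m := by
  by_contra! hcon
  refine hu.not_ge ?_
  calc m ^ q = ∫⁻ _ in Ioo a (a + 1), m ^ q := by simp
    _ ≤ ∫⁻ t in Ioo a (a + 1), ‖u t‖ₑ ^ q :=
        setLIntegral_mono' measurableSet_Ioo fun t ht => by
          gcongr
          exact (hcon t ht).le
    _ ≤ _ := lintegral_mono_set hJ

end

theorem statement10 {X : Type*} [NormedAddCommGroup X] [NormedSpace ℝ X] [CompleteSpace X]
    (q σ δ : ℝ) (hq : 1 < q) (hδ0 : 0 ≤ δ) (hδ1 : δ < 1)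
    (hσ0 : 0 < σ) (hσ1 : σ < 1) (hqδσ : 1 / q + δ < σ) :
    ∃ C > (0 : ℝ), ∀ T : ℝ≥0∞, 0 < T → ∀ u : ℝ → X,
      ContinuousOn u (insert (0:ℝ) (timeSet T)) → u 0 = 0 →
      wsNormSet q σ (timeSet T) u < ⊤ →
      (⨆ t ∈ insert (0:ℝ) (timeSet T), (‖u t‖₊ : ℝ≥0∞)) +
          (⨆ t ∈ insert (0:ℝ) (timeSet T), ⨆ s ∈ insert (0:ℝ) (timeSet T), ⨆ _ : t ≠ s,
            (‖u t - u s‖₊ : ℝ≥0∞) / (ENNReal.ofReal |t - s|) ^ δ) ≤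
        ENNReal.ofReal C * wsNormSet q σ (timeSet T) u := by
  have hq0 : 0 < q := zero_lt_one.trans hq
  have hα : 0 < σ - 1 / q := by linarith
  set α := σ - 1 / q with hα'
  have hδα : δ ≤ α := by linarith
  have hr1 : 0 < 1 - (1 / 2 : ℝ) ^ α :=
    sub_pos.2 (Real.rpow_lt_one (by norm_num) (by norm_num) hα)
  set c := 6 / (1 - (1 / 2 : ℝ) ^ α) with hc
  have hc0 : 0 < c := by positivity
  have hC : 0 < 3 * (1 + c) := by positivity
  refine ⟨3 * (1 + c), hC, fun T _ u hcont hu0 _ => ?_⟩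
  have hJ {a b : ℝ} (ha : a ∈ insert (0 : ℝ) (timeSet T)) (hb : b ∈ insert (0 : ℝ) (timeSet T)) :
      Ioo a b ⊆ timeSet T := by
    have ha0 : 0 ≤ a := by
      rcases ha with rfl | ha
      exacts [le_rfl, ha.1.le]
    intro t ht
    rcases hb with rfl | hb
    · linarith [ht.1, ht.2]
    · exact ⟨ha0.trans_lt ht.1, (ENNReal.ofReal_le_ofReal ht.2.le).trans_lt hb.2⟩
  rw [mul_comm, ← ENNReal.div_le_iff (ENNReal.ofReal_pos.2 hC).ne' ENNReal.ofReal_ne_top]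
  refine le_of_forall_gt_imp_ge_of_dense fun m hm => ?_
  rcases eq_or_ne m ⊤ with rfl | hmt
  · exact le_top
  obtain ⟨M, hM, rfl⟩ : ∃ M : ℝ, 0 < M ∧ ENNReal.ofReal M = m :=
    ⟨m.toReal, ENNReal.toReal_pos (ne_bot_of_gt hm) hmt, ENNReal.ofReal_toReal hmt⟩
  rw [ENNReal.div_le_iff (ENNReal.ofReal_pos.2 hC).ne' ENNReal.ofReal_ne_top, mul_comm, ← ENNReal.ofReal_mul hC.le]
  have hLq : ∫⁻ t in timeSet T, ‖u t‖ₑ ^ q < ENNReal.ofReal M ^ q := by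
    have h := le_self_add.trans_lt hm
    rwa [one_div, ENNReal.rpow_inv_lt_iff hq0] at h
  have hsemi : ∫⁻ t in timeSet T, ∫⁻ s in timeSet T,
      ‖u t - u s‖ₑ ^ q / (ENNReal.ofReal |t - s|) ^ (1 + σ * q) ≤ ENNReal.ofReal (M ^ q) := by
    have h := le_add_self.trans hm.le
    rwa [one_div, ENNReal.rpow_inv_le_iff hq0, ENNReal.ofReal_rpow_of_pos hM] at h
  have hlt {a b : ℝ} (ha : a ∈ insert (0 : ℝ) (timeSet T))
      (hb : b ∈ insert (0 : ℝ) (timeSet T)) (hab : a < b) :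
      ‖u a - u b‖ₑ ≤ ENNReal.ofReal (c * M * |a - b| ^ α) := by
    rw [abs_sub_comm, abs_of_pos (sub_pos.2 hab)]
    exact enorm_sub_le_of_seminorm_le hq hσ0 hα hM hab (subset_insert _ _) hcont ha hb
      (hJ ha hb) hsemi
  have hne {a b : ℝ} (ha : a ∈ insert (0 : ℝ) (timeSet T))
      (hb : b ∈ insert (0 : ℝ) (timeSet T)) (hab : a ≠ b) :
      ‖u a - u b‖ₑ ≤ ENNReal.ofReal (c * M * |a - b| ^ α) := by
    rcases hab.lt_or_gt with h | h
    · exact hlt ha hb h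
    · rw [← enorm_neg, neg_sub, abs_sub_comm]
      exact hlt hb ha h
  have hne_one {a b : ℝ} (ha : a ∈ insert (0 : ℝ) (timeSet T))
      (hb : b ∈ insert (0 : ℝ) (timeSet T)) (hab : a ≠ b) (h1 : |a - b| ≤ 1) :
      ‖u a - u b‖ₑ ≤ ENNReal.ofReal (c * M) := by
    refine (hne ha hb hab).trans (ENNReal.ofReal_le_ofReal ?_)
    exact mul_le_of_le_one_right (by positivity) (Real.rpow_le_one (abs_nonneg _) h1 hα.le)
  have hsup {t : ℝ} (ht : t ∈ insert (0 : ℝ) (timeSet T)) :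
      ‖u t‖ₑ ≤ ENNReal.ofReal ((1 + c) * M) := by
    have h0 : (0 : ℝ) ∈ insert (0 : ℝ) (timeSet T) := mem_insert _ _
    rcases eq_or_ne t 0 with rfl | ht0
    · simp [hu0]
    have htpos : 0 < t := (ht.resolve_left ht0).1
    rcases le_or_gt t 1 with ht1 | ht1
    · have h := hne_one ht h0 ht0 (by simpa [abs_of_pos htpos] using ht1)
      rw [hu0, sub_zero] at h
      refine h.trans (ENNReal.ofReal_le_ofReal ?_)
      nlinarith
    · have hsub : Ioo (t - 1) (t - 1 + 1) ⊆ timeSet T := by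
        rw [sub_add_cancel]
        exact (Ioo_subset_Ioo_left (by linarith)).trans (hJ h0 ht)
      obtain ⟨r, hr, hur⟩ := exists_enorm_le_of_lintegral_rpow_lt hq0 hsub hLq
      have hrt : |r - t| ≤ 1 := by
        rw [abs_le]; constructor <;> linarith [hr.1, hr.2]
      have h := hne_one ht (subset_insert _ _ (hsub hr)) (by linarith [hr.2] : r < t).ne'
        (by rwa [abs_sub_comm])
      calc ‖u t‖ₑ ≤ ‖u r‖ₑ + ‖u t - u r‖ₑ := by simpa using enorm_add_le (u r) (u t - u r)
        _ ≤ ENNReal.ofReal M + ENNReal.ofReal (c * M) := add_le_add hur h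
        _ = _ := by
          rw [← ENNReal.ofReal_add hM.le (by positivity)]
          congr 1
          ring
  have hhol {t s : ℝ} (ht : t ∈ insert (0 : ℝ) (timeSet T))
      (hs : s ∈ insert (0 : ℝ) (timeSet T)) (hts : t ≠ s) :
      ‖u t - u s‖ₑ ≤ ENNReal.ofReal (2 * (1 + c) * M) * ENNReal.ofReal |t - s| ^ δ := by
    have hd : 0 < |t - s| := abs_pos.2 (sub_ne_zero.2 hts)
    rw [ENNReal.ofReal_rpow_of_pos hd, ← ENNReal.ofReal_mul (by positivity)]
    rcases le_or_gt |t - s| 1 with h1 | h1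
    · refine (hne ht hs hts).trans (ENNReal.ofReal_le_ofReal ?_)
      have := Real.rpow_le_rpow_of_exponent_ge hd h1 hδα
      gcongr
      linarith
    · calc ‖u t - u s‖ₑ ≤ ‖u t‖ₑ + ‖u s‖ₑ := enorm_sub_le
        _ ≤ ENNReal.ofReal ((1 + c) * M) + ENNReal.ofReal ((1 + c) * M) :=
          add_le_add (hsup ht) (hsup hs)
        _ = ENNReal.ofReal (2 * (1 + c) * M) := by
          rw [← ENNReal.ofReal_add (by positivity) (by positivity)]
          congr 1
          ring
        _ ≤ _ := ENNReal.ofReal_le_ofReal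
          (le_mul_of_one_le_right (by positivity) (Real.one_le_rpow h1.le hδ0))
  have hsum : 3 * (1 + c) * M = (1 + c) * M + 2 * (1 + c) * M := by ring
  rw [hsum, ENNReal.ofReal_add (by positivity) (by positivity)]
  refine add_le_add (iSup₂_le fun t ht => ?_)
    (iSup₂_le fun t ht => iSup₂_le fun s hs => iSup_le fun hts => ?_)
  · exact hsup ht
  · exact ENNReal.div_le_of_le_mul (hhol ht hs hts)
end
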